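/- The integrals H1 = (M, ω) and H2 = (M, M) are in involution with respect to the bracket {·,·}_b: {H1, H2}_b = 0. -/

import Mathlib

open scoped BigOperators
noncomputable section

/-- ℝ³ as functions `Fin 3 → ℝ`. -/
abbrev R3 := Fin 3 → ℝ

/-- Phase space: pairs `(γ, M)`. -/
abbrev St := R3 × R3

/-- Standard scalar product in ℝ³. -/
def dot3 (x y : R3) : ℝ := ∑ i, x i * y i

/-- Cross product in ℝ³. -/
def cross (x y : R3) : R3 :=
  ![x 1 * y 2 - x 2 * y 1, x 2 * y 0 - x 0 * y 2, x 0 * y 1 - x 1 * y 0]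

/-- Levi-Civita symbol. -/
def eps (i j k : Fin 3) : ℝ :=
  ((((j : ℤ) - (i : ℤ)) * ((k : ℤ) - (i : ℤ)) * ((k : ℤ) - (j : ℤ))) / 2 : ℤ)

/-- Application of the diagonal matrix A = diag a. -/
def Aapp (a : R3) (v : R3) : R3 := fun i => a i * v i

/-- Angular velocity ω expressed through M. -/
def omg (a : R3) (d : ℝ) (x : St) : R3 := fun i =>
  a i * x.2 i + d * dot3 x.1 (Aapp a x.2) / (1 - d * dot3 x.1 (Aapp a x.1)) * (a i * x.1 i)

/-- g(γ) = sqrt(1 - d (γ, Aγ)). -/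
def gfun (a : R3) (d : ℝ) (γ : R3) : ℝ := Real.sqrt (1 - d * dot3 γ (Aapp a γ))

/-- Partial derivative in the γ (inl) or M (inr) direction. -/
def pd : (Fin 3 ⊕ Fin 3) → (St → ℝ) → St → ℝ
  | .inl i, F, x => fderiv ℝ F x (Pi.single i 1, 0)
  | .inr i, F, x => fderiv ℝ F x (0, Pi.single i 1)

/-- Bracket of two functions determined by a structure matrix π. -/
def pb (π : St → (Fin 3 ⊕ Fin 3) → (Fin 3 ⊕ Fin 3) → ℝ) (F G : St → ℝ) (x : St) : ℝ :=
  ∑ u, ∑ v, π x u v * pd u F x * pd v G x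

/-- Structure matrix of the bracket {·,·}_g. -/
def piG (a : R3) (d : ℝ) (x : St) : (Fin 3 ⊕ Fin 3) → (Fin 3 ⊕ Fin 3) → ℝ
  | .inl _, .inl _ => 0
  | .inl i, .inr j => ∑ k, eps i j k * gfun a d x.1 * x.1 k
  | .inr i, .inl j => ∑ k, eps i j k * gfun a d x.1 * x.1 k
  | .inr i, .inr j => ∑ k, eps i j k *
      (gfun a d x.1 * x.2 k - d * dot3 x.2 (Aapp a x.1) * x.1 k / gfun a d x.1)

/-- Coordinate functions on the phase space. -/
def coordFn : (Fin 3 ⊕ Fin 3) → St → ℝ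
  | .inl i => fun x => x.1 i
  | .inr i => fun x => x.2 i

/-- Entries of B = tr(A⁻¹)E - 2A⁻¹ (the case κ = -1): b_i = tr A⁻¹ - 2/a_i. -/
def bb (a : R3) (i : Fin 3) : ℝ := (∑ m, (a m)⁻¹) - 2 * (a i)⁻¹

/-- α_k = C₂ + b_k (γ, M) with C₂ = (γ, B M). -/
def alf (a : R3) (x : St) (k : Fin 3) : ℝ :=
  (∑ m, x.1 m * bb a m * x.2 m) + bb a k * dot3 x.1 x.2

/-- The table of brackets {M_i, γ_j}_b. -/
def pmg (a : R3) (d : ℝ) (γ : R3) : Fin 3 → Fin 3 → ℝ :=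
  let g := gfun a d γ
  let b := bb a
  ![![ g * (b 1 - b 2) * γ 0 * γ 1 * γ 2,
       g * γ 2 * (b 2 * (γ 0 ^ 2 + γ 2 ^ 2) + b 1 * γ 1 ^ 2 - b 1 * b 2 / (2 * d)),
       -(g * γ 1 * (b 1 * (γ 0 ^ 2 + γ 1 ^ 2) + b 2 * γ 2 ^ 2 - b 1 * b 2 / (2 * d))) ],
    ![ -(g * γ 2 * (b 0 * γ 0 ^ 2 + b 2 * (γ 1 ^ 2 + γ 2 ^ 2) - b 0 * b 2 / (2 * d))),
       g * (b 2 - b 0) * γ 0 * γ 1 * γ 2,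
       g * γ 0 * (b 0 * (γ 0 ^ 2 + γ 1 ^ 2) + b 2 * γ 2 ^ 2 - b 0 * b 2 / (2 * d)) ],
    ![ g * γ 1 * (b 0 * γ 0 ^ 2 + b 1 * (γ 1 ^ 2 + γ 2 ^ 2) - b 0 * b 1 / (2 * d)),
       -(g * γ 0 * (b 0 * (γ 0 ^ 2 + γ 2 ^ 2) + b 1 * γ 1 ^ 2 - b 0 * b 1 / (2 * d))),
       g * (b 0 - b 1) * γ 0 * γ 1 * γ 2 ]]

/-- The component f_k with {M_i, M_j}_b = Σ_k ε_ijk f_k. -/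
def fmm (a : R3) (d : ℝ) (x : St) (k : Fin 3) : ℝ :=
  let g := gfun a d x.1
  let b := bb a
  g * (-(alf a x k) * x.1 k + dot3 x.1 x.1 * b k * x.2 k - (b k) ^ 2 * x.2 k / (2 * d))
  - g⁻¹ * x.1 k * (2 * d * dot3 x.1 x.1 - (b 0 + b 1 + b 2)) *
    ( alf a x k * b k / (∏ m ∈ Finset.univ.filter (fun m => m ≠ k), (b k + b m))
      + (∏ m ∈ Finset.univ.filter (fun m => m ≠ k), (b k - b m)) * b k * x.1 k * x.2 k /
          ((b 0 + b 1) * (b 1 + b 2) * (b 0 + b 2)) )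

/-- Structure matrix of the κ = -1 bracket {·,·}_b. -/
def piB (a : R3) (d : ℝ) (x : St) : (Fin 3 ⊕ Fin 3) → (Fin 3 ⊕ Fin 3) → ℝ
  | .inl _, .inl _ => 0
  | .inl i, .inr j => -(pmg a d x.1 j i)
  | .inr i, .inl j => pmg a d x.1 i j
  | .inr i, .inr j => ∑ k, eps i j k * fmm a d x k

lemma fderiv_H2_apply (x v : St) :
    fderiv ℝ (fun y : St => dot3 y.2 y.2) x v =
      2 * (x.2 0 * v.2 0 + x.2 1 * v.2 1 + x.2 2 * v.2 2) := by
  have hdiff : DifferentiableAt ℝ (fun y : St => dot3 y.2 y.2) x := by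
    simp only [dot3, Fin.sum_univ_three]
    fun_prop
  rw [← hdiff.lineDeriv_eq_fderiv]
  have lin : ∀ p q : ℝ, HasDerivAt (fun t : ℝ => p + t * q) q 0 := fun p q => by
    simpa using ((hasDerivAt_id (0:ℝ)).mul_const q).const_add p
  have e : ∀ i : Fin 3, HasDerivAt (fun t : ℝ => (x.2 i + t * v.2 i)) (v.2 i) 0 :=
    fun i => lin _ _
  have h := (((e 0).mul (e 0)).add ((e 1).mul (e 1))).add ((e 2).mul (e 2))
  have h2 : HasLineDerivAt ℝ (fun y : St => dot3 y.2 y.2)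
      (2 * (x.2 0 * v.2 0 + x.2 1 * v.2 1 + x.2 2 * v.2 2)) x v := by
    unfold HasLineDerivAt
    simp only [dot3, Fin.sum_univ_three]
    refine (h.congr_deriv ?_)
    simp
    ring
  exact h2.lineDeriv

lemma fderiv_H1_apply (a : R3) (d : ℝ) (x v : St)
    (hx : 1 - d * dot3 x.1 (Aapp a x.1) ≠ 0) :
    fderiv ℝ (fun y : St => dot3 y.2 (Aapp a y.2) +
        d * (dot3 y.1 (Aapp a y.2))^2 / (1 - d * dot3 y.1 (Aapp a y.1))) x v =
      2 * dot3 x.2 (Aapp a v.2) +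
      2 * d * dot3 x.1 (Aapp a x.2) * (dot3 x.1 (Aapp a v.2) + dot3 v.1 (Aapp a x.2)) *
        (1 - d * dot3 x.1 (Aapp a x.1))⁻¹
      + 2 * d ^ 2 * dot3 x.1 (Aapp a x.2) ^ 2 * dot3 x.1 (Aapp a v.1) *
        ((1 - d * dot3 x.1 (Aapp a x.1))⁻¹) ^ 2 := by
  have hdiff : DifferentiableAt ℝ (fun y : St => dot3 y.2 (Aapp a y.2) +
        d * (dot3 y.1 (Aapp a y.2))^2 / (1 - d * dot3 y.1 (Aapp a y.1))) x := by
    simp only [dot3, Aapp, Fin.sum_univ_three] at hx ⊢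
    fun_prop (disch := exact hx)
  rw [← hdiff.lineDeriv_eq_fderiv]
  have lin : ∀ p q : ℝ, HasDerivAt (fun t : ℝ => p + t * q) q 0 := fun p q => by
    simpa using ((hasDerivAt_id (0:ℝ)).mul_const q).const_add p
  have bil : ∀ p q r s : R3, HasDerivAt (fun t : ℝ => dot3 (p + t • q) (Aapp a (r + t • s)))
      (dot3 q (Aapp a r) + dot3 p (Aapp a s)) 0 := fun p q r s => by
    have e : ∀ i : Fin 3, HasDerivAt (fun t : ℝ => (p i + t * q i) * (a i * (r i + t * s i)))
        (q i * (a i * r i) + p i * (a i * s i)) 0 := fun i =>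
      ((lin (p i) (q i)).mul ((lin (r i) (s i)).const_mul (a i))).congr_deriv (by simp)
    simp only [dot3, Aapp, Fin.sum_univ_three]
    exact (((e 0).add (e 1)).add (e 2)).congr_deriv (by ring)
  have symm : ∀ p q : R3, dot3 p (Aapp a q) = dot3 q (Aapp a p) := fun p q => by
    simp only [dot3, Aapp, Fin.sum_univ_three]; ring
  have h := (bil x.2 v.2 x.2 v.2).add
    ((((bil x.1 v.1 x.2 v.2).pow 2).const_mul d).div
      (((bil x.1 v.1 x.1 v.1).const_mul d).const_sub 1) (by simpa using hx))
  have h2 : HasLineDerivAt ℝ (fun y : St => dot3 y.2 (Aapp a y.2) +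
        d * (dot3 y.1 (Aapp a y.2))^2 / (1 - d * dot3 y.1 (Aapp a y.1)))
      (2 * dot3 x.2 (Aapp a v.2) +
      2 * d * dot3 x.1 (Aapp a x.2) * (dot3 x.1 (Aapp a v.2) + dot3 v.1 (Aapp a x.2)) *
        (1 - d * dot3 x.1 (Aapp a x.1))⁻¹
      + 2 * d ^ 2 * dot3 x.1 (Aapp a x.2) ^ 2 * dot3 x.1 (Aapp a v.1) *
        ((1 - d * dot3 x.1 (Aapp a x.1))⁻¹) ^ 2) x v := by
    unfold HasLineDerivAt
    refine (h.congr_deriv ?_)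
    simp only [zero_smul, add_zero]
    rw [symm v.2 x.2, symm v.1 x.1]
    generalize 1 - d * dot3 x.1 (Aapp a x.1) = w at hx ⊢
    field_simp
    simp
    ring
  exact h2.lineDeriv

set_option maxHeartbeats 4000000 in
/-- The algebraic core, with `c = 1/a`, after clearing denominators;
`W = g² c₀ c₁ c₂`, `N = 8 c₀ c₁ c₂`. -/
lemma core (c0 c1 c2 d x y z p q r : ℝ) :
    let b0 := c1 + c2 - c0
    let b1 := c0 + c2 - c1
    let b2 := c0 + c1 - c2
    let a0 := c1 * c2
    let a1 := c0 * c2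
    let a2 := c0 * c1
    let n := x ^ 2 + y ^ 2 + z ^ 2
    let m := x * p + y * q + z * r
    let C := x * b0 * p + y * b1 * q + z * b2 * r
    let L := a0 * x * p + a1 * y * q + a2 * z * r
    let W := c0 * c1 * c2 - d * (a0 * x ^ 2 + a1 * y ^ 2 + a2 * z ^ 2)
    let K := 2 * d * n - (b0 + b1 + b2)
    let A0 := 2 * d * (-(C + b0 * m) * x + n * b0 * p) - b0 ^ 2 * p
    let A1 := 2 * d * (-(C + b1 * m) * y + n * b1 * q) - b1 ^ 2 * q
    let A2 := 2 * d * (-(C + b2 * m) * z + n * b2 * r) - b2 ^ 2 * r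
    let B0 := x * b0 * (2 * c0 * (C + b0 * m) + (b0 - b1) * (b0 - b2) * x * p)
    let B1 := y * b1 * (2 * c1 * (C + b1 * m) + (b1 - b0) * (b1 - b2) * y * q)
    let B2 := z * b2 * (2 * c2 * (C + b2 * m) + (b2 - b0) * (b2 - b1) * z * r)
    let S0 := 2 * d * (b1 - b2) * x * y * z * p
      - z * (2 * d * (b0 * x ^ 2 + b2 * (y ^ 2 + z ^ 2)) - b0 * b2) * q
      + y * (2 * d * (b0 * x ^ 2 + b1 * (y ^ 2 + z ^ 2)) - b0 * b1) * r
    let S1 := z * (2 * d * (b2 * (x ^ 2 + z ^ 2) + b1 * y ^ 2) - b1 * b2) * p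
      + 2 * d * (b2 - b0) * x * y * z * q
      - x * (2 * d * (b0 * (x ^ 2 + z ^ 2) + b1 * y ^ 2) - b0 * b1) * r
    let S2 := -y * (2 * d * (b1 * (x ^ 2 + y ^ 2) + b2 * z ^ 2) - b1 * b2) * p
      + x * (2 * d * (b0 * (x ^ 2 + y ^ 2) + b2 * z ^ 2) - b0 * b2) * q
      + 2 * d * (b0 - b1) * x * y * z * r
    (4 * W * A0 - d * K * B0) * (W * (a1 * q * r - a2 * r * q) + d * L * (a1 * y * r - a2 * z * q))
    + (4 * W * A1 - d * K * B1) * (W * (a2 * r * p - a0 * p * r) + d * L * (a2 * z * p - a0 * x * r))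
    + (4 * W * A2 - d * K * B2) * (W * (a0 * p * q - a1 * q * p) + d * L * (a0 * x * q - a1 * y * p))
    - 4 * d * L * (S0 * a0 * (W * p + d * L * x) + S1 * a1 * (W * q + d * L * y)
      + S2 * a2 * (W * r + d * L * z)) = 0 := by
  intros
  ring

/-- H1 = (M,ω) and H2 = (M,M) are in involution with respect to {·,·}_b. -/
theorem involution_H1_H2_b_bracket
    (a : R3) (d : ℝ) (hd : 0 < d) (ha : ∀ i, a i ≠ 0)
    (hb : ∀ i j : Fin 3, bb a i + bb a j ≠ 0)
    (x : St) (hx : 0 < 1 - d * dot3 x.1 (Aapp a x.1)) :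
    pb (piB a d)
      (fun y => dot3 y.2 (Aapp a y.2) +
        d * (dot3 y.1 (Aapp a y.2))^2 / (1 - d * dot3 y.1 (Aapp a y.1)))
      (fun y => dot3 y.2 y.2) x = 0 := by
  have hx0 := hx.ne'
  have hg : gfun a d x.1 ≠ 0 := (Real.sqrt_pos.2 hx).ne'
  have hg2 : (gfun a d x.1)^2 = 1 - d * dot3 x.1 (Aapp a x.1) := Real.sq_sqrt hx.le
  have e1 : ∀ u, pd u (fun y : St => dot3 y.2 y.2) x =
      Sum.elim (fun _ => 0) (fun i => 2 * x.2 i) u := by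
    rintro (i | i) <;> fin_cases i <;> simp [pd, fderiv_H2_apply]
  have f0 : (Finset.univ.filter (fun m : Fin 3 => m ≠ 0)) = {1, 2} := by decide
  have f1 : (Finset.univ.filter (fun m : Fin 3 => m ≠ 1)) = {0, 2} := by decide
  have f2 : (Finset.univ.filter (fun m : Fin 3 => m ≠ 2)) = {0, 1} := by decide
  have hF : ∀ u, pd u (fun y : St => dot3 y.2 (Aapp a y.2) +
        d * (dot3 y.1 (Aapp a y.2))^2 / (1 - d * dot3 y.1 (Aapp a y.1))) x =
      Sum.elim (fun i => 2 * d * dot3 x.1 (Aapp a x.2) * (a i * x.2 i) *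
          ((gfun a d x.1)^2)⁻¹ + 2 * d ^ 2 * dot3 x.1 (Aapp a x.2) ^ 2 * (a i * x.1 i) *
          (((gfun a d x.1)^2)⁻¹) ^ 2)
        (fun i => 2 * (a i * x.2 i) + 2 * d * dot3 x.1 (Aapp a x.2) * (a i * x.1 i) *
          ((gfun a d x.1)^2)⁻¹) u := by
    rw [hg2]
    have s1 : ∀ (p : R3) i, dot3 p (Aapp a (Pi.single i 1)) = a i * p i := fun p i => by
      fin_cases i <;> simp [dot3, Aapp, Fin.sum_univ_three, mul_comm]
    have s2 : ∀ (p : R3) i, dot3 (Pi.single i 1) (Aapp a p) = a i * p i := fun p i => by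
      fin_cases i <;> simp [dot3, Aapp, Fin.sum_univ_three]
    have s3 : ∀ (p : R3), dot3 p (Aapp a 0) = 0 := fun p => by simp [dot3, Aapp]
    have s4 : ∀ (p : R3), dot3 0 (Aapp a p) = 0 := fun p => by simp [dot3]
    rintro (i | i) <;> simp [pd, fderiv_H1_apply a d x _ hx0, s1, s2, s3, s4]
  obtain ⟨γ, M⟩ := x
  dsimp only at *
  have key := core (a 0)⁻¹ (a 1)⁻¹ (a 2)⁻¹ d (γ 0) (γ 1) (γ 2) (M 0) (M 1) (M 2)
  obtain ⟨c0, hc0⟩ : ∃ c, c = (a 0)⁻¹ := ⟨_, rfl⟩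
  obtain ⟨c1, hc1⟩ : ∃ c, c = (a 1)⁻¹ := ⟨_, rfl⟩
  obtain ⟨c2, hc2⟩ : ∃ c, c = (a 2)⁻¹ := ⟨_, rfl⟩
  have n0 : c0 ≠ 0 := by rw [hc0]; exact inv_ne_zero (ha 0)
  have n1 : c1 ≠ 0 := by rw [hc1]; exact inv_ne_zero (ha 1)
  have n2 : c2 ≠ 0 := by rw [hc2]; exact inv_ne_zero (ha 2)
  have ha0 : a 0 = c0⁻¹ := by rw [hc0, inv_inv]
  have ha1 : a 1 = c1⁻¹ := by rw [hc1, inv_inv]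
  have ha2 : a 2 = c2⁻¹ := by rw [hc2, inv_inv]
  have hb0 : bb a 0 = c1 + c2 - c0 := by
    simp only [bb, Fin.sum_univ_three, ← hc0, ← hc1, ← hc2]; ring
  have hb1 : bb a 1 = c0 + c2 - c1 := by
    simp only [bb, Fin.sum_univ_three, ← hc0, ← hc1, ← hc2]; ring
  have hb2 : bb a 2 = c0 + c1 - c2 := by
    simp only [bb, Fin.sum_univ_three, ← hc0, ← hc1, ← hc2]; ring
  rw [← hc0, ← hc1, ← hc2] at key
  have dn : d ≠ 0 := hd.ne'
  obtain ⟨G, hG⟩ : ∃ G, G = gfun a d γ := ⟨_, rfl⟩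
  rw [← hG] at hg hg2 hF
  obtain ⟨L, hL⟩ : ∃ v, v = (c1 * c2) * γ 0 * M 0 + (c0 * c2) * γ 1 * M 1 + (c0 * c1) * γ 2 * M 2 := ⟨_, rfl⟩
  obtain ⟨W, hW⟩ : ∃ v, v = c0 * c1 * c2 - d * ((c1 * c2) * γ 0 ^ 2 + (c0 * c2) * γ 1 ^ 2 + (c0 * c1) * γ 2 ^ 2) := ⟨_, rfl⟩
  obtain ⟨K, hK⟩ : ∃ v, v = 2 * d * (γ 0 ^ 2 + γ 1 ^ 2 + γ 2 ^ 2) - ((c1 + c2 - c0) + (c0 + c2 - c1) + (c0 + c1 - c2)) := ⟨_, rfl⟩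
  obtain ⟨A0, hA0⟩ : ∃ v, v = 2 * d * (-((γ 0 * (c1 + c2 - c0) * M 0 + γ 1 * (c0 + c2 - c1) * M 1 + γ 2 * (c0 + c1 - c2) * M 2) + (c1 + c2 - c0) * (γ 0 * M 0 + γ 1 * M 1 + γ 2 * M 2)) * γ 0 + (γ 0 ^ 2 + γ 1 ^ 2 + γ 2 ^ 2) * (c1 + c2 - c0) * M 0) - (c1 + c2 - c0) ^ 2 * M 0 := ⟨_, rfl⟩
  obtain ⟨A1, hA1⟩ : ∃ v, v = 2 * d * (-((γ 0 * (c1 + c2 - c0) * M 0 + γ 1 * (c0 + c2 - c1) * M 1 + γ 2 * (c0 + c1 - c2) * M 2) + (c0 + c2 - c1) * (γ 0 * M 0 + γ 1 * M 1 + γ 2 * M 2)) * γ 1 + (γ 0 ^ 2 + γ 1 ^ 2 + γ 2 ^ 2) * (c0 + c2 - c1) * M 1) - (c0 + c2 - c1) ^ 2 * M 1 := ⟨_, rfl⟩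
  obtain ⟨A2, hA2⟩ : ∃ v, v = 2 * d * (-((γ 0 * (c1 + c2 - c0) * M 0 + γ 1 * (c0 + c2 - c1) * M 1 + γ 2 * (c0 + c1 - c2) * M 2) + (c0 + c1 - c2) * (γ 0 * M 0 + γ 1 * M 1 + γ 2 * M 2)) * γ 2 + (γ 0 ^ 2 + γ 1 ^ 2 + γ 2 ^ 2) * (c0 + c1 - c2) * M 2) - (c0 + c1 - c2) ^ 2 * M 2 := ⟨_, rfl⟩
  obtain ⟨B0, hB0⟩ : ∃ v, v = γ 0 * (c1 + c2 - c0) * (2 * c0 * ((γ 0 * (c1 + c2 - c0) * M 0 + γ 1 * (c0 + c2 - c1) * M 1 + γ 2 * (c0 + c1 - c2) * M 2) + (c1 + c2 - c0) * (γ 0 * M 0 + γ 1 * M 1 + γ 2 * M 2)) + ((c1 + c2 - c0) - (c0 + c2 - c1)) * ((c1 + c2 - c0) - (c0 + c1 - c2)) * γ 0 * M 0) := ⟨_, rfl⟩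
  obtain ⟨B1, hB1⟩ : ∃ v, v = γ 1 * (c0 + c2 - c1) * (2 * c1 * ((γ 0 * (c1 + c2 - c0) * M 0 + γ 1 * (c0 + c2 - c1) * M 1 + γ 2 * (c0 + c1 - c2) * M 2) + (c0 + c2 - c1) * (γ 0 * M 0 + γ 1 * M 1 + γ 2 * M 2)) + ((c0 + c2 - c1) - (c1 + c2 - c0)) * ((c0 + c2 - c1) - (c0 + c1 - c2)) * γ 1 * M 1) := ⟨_, rfl⟩
  obtain ⟨B2, hB2⟩ : ∃ v, v = γ 2 * (c0 + c1 - c2) * (2 * c2 * ((γ 0 * (c1 + c2 - c0) * M 0 + γ 1 * (c0 + c2 - c1) * M 1 + γ 2 * (c0 + c1 - c2) * M 2) + (c0 + c1 - c2) * (γ 0 * M 0 + γ 1 * M 1 + γ 2 * M 2)) + ((c0 + c1 - c2) - (c1 + c2 - c0)) * ((c0 + c1 - c2) - (c0 + c2 - c1)) * γ 2 * M 2) := ⟨_, rfl⟩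
  obtain ⟨S0, hS0⟩ : ∃ v, v = 2 * d * ((c0 + c2 - c1) - (c0 + c1 - c2)) * γ 0 * γ 1 * γ 2 * M 0 - γ 2 * (2 * d * ((c1 + c2 - c0) * γ 0 ^ 2 + (c0 + c1 - c2) * (γ 1 ^ 2 + γ 2 ^ 2)) - (c1 + c2 - c0) * (c0 + c1 - c2)) * M 1 + γ 1 * (2 * d * ((c1 + c2 - c0) * γ 0 ^ 2 + (c0 + c2 - c1) * (γ 1 ^ 2 + γ 2 ^ 2)) - (c1 + c2 - c0) * (c0 + c2 - c1)) * M 2 := ⟨_, rfl⟩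
  obtain ⟨S1, hS1⟩ : ∃ v, v = γ 2 * (2 * d * ((c0 + c1 - c2) * (γ 0 ^ 2 + γ 2 ^ 2) + (c0 + c2 - c1) * γ 1 ^ 2) - (c0 + c2 - c1) * (c0 + c1 - c2)) * M 0 + 2 * d * ((c0 + c1 - c2) - (c1 + c2 - c0)) * γ 0 * γ 1 * γ 2 * M 1 - γ 0 * (2 * d * ((c1 + c2 - c0) * (γ 0 ^ 2 + γ 2 ^ 2) + (c0 + c2 - c1) * γ 1 ^ 2) - (c1 + c2 - c0) * (c0 + c2 - c1)) * M 2 := ⟨_, rfl⟩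
  obtain ⟨S2, hS2⟩ : ∃ v, v = -γ 1 * (2 * d * ((c0 + c2 - c1) * (γ 0 ^ 2 + γ 1 ^ 2) + (c0 + c1 - c2) * γ 2 ^ 2) - (c0 + c2 - c1) * (c0 + c1 - c2)) * M 0 + γ 0 * (2 * d * ((c1 + c2 - c0) * (γ 0 ^ 2 + γ 1 ^ 2) + (c0 + c1 - c2) * γ 2 ^ 2) - (c1 + c2 - c0) * (c0 + c1 - c2)) * M 1 + 2 * d * ((c1 + c2 - c0) - (c0 + c2 - c1)) * γ 0 * γ 1 * γ 2 * M 2 := ⟨_, rfl⟩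
  have hGW : G ^ 2 = W / (c0 * c1 * c2) := by
    rw [hg2, hW]
    simp only [dot3, Aapp, Fin.sum_univ_three, ha0, ha1, ha2]
    field_simp
  have hWn : W ≠ 0 := by
    intro h
    rw [h, zero_div] at hGW
    exact hg (pow_eq_zero_iff (two_ne_zero) |>.1 hGW)
  have hLL : dot3 γ (Aapp a M) = L / (c0 * c1 * c2) := by
    rw [hL]
    simp only [dot3, Aapp, Fin.sum_univ_three, ha0, ha1, ha2]
    field_simp
  have q01 : c1 + c2 - c0 + (c0 + c2 - c1) = 2 * c2 := by ring
  have q10 : c0 + c2 - c1 + (c1 + c2 - c0) = 2 * c2 := by ring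
  have q02 : c1 + c2 - c0 + (c0 + c1 - c2) = 2 * c1 := by ring
  have q20 : c0 + c1 - c2 + (c1 + c2 - c0) = 2 * c1 := by ring
  have q12 : c0 + c2 - c1 + (c0 + c1 - c2) = 2 * c0 := by ring
  have q21 : c0 + c1 - c2 + (c0 + c2 - c1) = 2 * c0 := by ring
  have hf0 : fmm a d (γ, M) 0 = G * (A0 / (2 * d)) - G⁻¹ * K * (B0 / (8 * (c0 * c1 * c2))) := by
    have e : fmm a d (γ, M) 0 = G * (A0 / (2 * d)) - G⁻¹ * γ 0 * K *
        (alf a (γ, M) 0 * bb a 0 / ((bb a 0 + bb a 1) * (bb a 0 + bb a 2))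
        + ((bb a 0 - bb a 1) * (bb a 0 - bb a 2)) * bb a 0 * γ 0 * M 0 /
          ((bb a 0 + bb a 1) * (bb a 1 + bb a 2) * (bb a 0 + bb a 2))) := by
      have t1 : A0 / (2 * d) = -(alf a (γ, M) 0) * γ 0 + dot3 γ γ * bb a 0 * M 0
          - (bb a 0) ^ 2 * M 0 / (2 * d) := by
        rw [hA0]
        simp only [alf, dot3, Fin.sum_univ_three, hb0, hb1, hb2]
        field_simp
      have t2 : K = 2 * d * dot3 γ γ - (bb a 0 + bb a 1 + bb a 2) := by
        rw [hK]
        simp only [dot3, Fin.sum_univ_three, hb0, hb1, hb2]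
        ring
      rw [t1, t2]
      simp only [fmm, f0, ← hG]
      rw [Finset.prod_pair (by decide), Finset.prod_pair (by decide)]
    rw [e]
    have t3 : (B0 / (8 * (c0 * c1 * c2))) = γ 0 * (alf a (γ, M) 0 * bb a 0 / ((bb a 0 + bb a 1) * (bb a 0 + bb a 2))
        + ((bb a 0 - bb a 1) * (bb a 0 - bb a 2)) * bb a 0 * γ 0 * M 0 /
          ((bb a 0 + bb a 1) * (bb a 1 + bb a 2) * (bb a 0 + bb a 2))) := by
      rw [hB0]
      simp only [alf, dot3, Fin.sum_univ_three, hb0, hb1, hb2, q01, q10, q02, q20, q12, q21]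
      field_simp
      ring
    rw [t3]
    ring
  have hS0' : pmg a d γ 0 0 * M 0 + pmg a d γ 1 0 * M 1 + pmg a d γ 2 0 * M 2
      = G * (S0 / (2 * d)) := by
    rw [hS0]
    simp [pmg, ← hG, hb0, hb1, hb2]
    field_simp
    ring
  have hf1 : fmm a d (γ, M) 1 = G * (A1 / (2 * d)) - G⁻¹ * K * (B1 / (8 * (c0 * c1 * c2))) := by
    have e : fmm a d (γ, M) 1 = G * (A1 / (2 * d)) - G⁻¹ * γ 1 * K *
        (alf a (γ, M) 1 * bb a 1 / ((bb a 1 + bb a 0) * (bb a 1 + bb a 2))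
        + ((bb a 1 - bb a 0) * (bb a 1 - bb a 2)) * bb a 1 * γ 1 * M 1 /
          ((bb a 0 + bb a 1) * (bb a 1 + bb a 2) * (bb a 0 + bb a 2))) := by
      have t1 : A1 / (2 * d) = -(alf a (γ, M) 1) * γ 1 + dot3 γ γ * bb a 1 * M 1
          - (bb a 1) ^ 2 * M 1 / (2 * d) := by
        rw [hA1]
        simp only [alf, dot3, Fin.sum_univ_three, hb0, hb1, hb2]
        field_simp
      have t2 : K = 2 * d * dot3 γ γ - (bb a 0 + bb a 1 + bb a 2) := by
        rw [hK]
        simp only [dot3, Fin.sum_univ_three, hb0, hb1, hb2]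
        ring
      rw [t1, t2]
      simp only [fmm, f1, ← hG]
      rw [Finset.prod_pair (by decide), Finset.prod_pair (by decide)]
    rw [e]
    have t3 : (B1 / (8 * (c0 * c1 * c2))) = γ 1 * (alf a (γ, M) 1 * bb a 1 / ((bb a 1 + bb a 0) * (bb a 1 + bb a 2))
        + ((bb a 1 - bb a 0) * (bb a 1 - bb a 2)) * bb a 1 * γ 1 * M 1 /
          ((bb a 0 + bb a 1) * (bb a 1 + bb a 2) * (bb a 0 + bb a 2))) := by
      rw [hB1]
      simp only [alf, dot3, Fin.sum_univ_three, hb0, hb1, hb2, q01, q10, q02, q20, q12, q21]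
      field_simp
      ring
    rw [t3]
    ring
  have hS1' : pmg a d γ 0 1 * M 0 + pmg a d γ 1 1 * M 1 + pmg a d γ 2 1 * M 2
      = G * (S1 / (2 * d)) := by
    rw [hS1]
    simp [pmg, ← hG, hb0, hb1, hb2]
    field_simp
    ring
  have hf2 : fmm a d (γ, M) 2 = G * (A2 / (2 * d)) - G⁻¹ * K * (B2 / (8 * (c0 * c1 * c2))) := by
    have e : fmm a d (γ, M) 2 = G * (A2 / (2 * d)) - G⁻¹ * γ 2 * K *
        (alf a (γ, M) 2 * bb a 2 / ((bb a 2 + bb a 0) * (bb a 2 + bb a 1))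
        + ((bb a 2 - bb a 0) * (bb a 2 - bb a 1)) * bb a 2 * γ 2 * M 2 /
          ((bb a 0 + bb a 1) * (bb a 1 + bb a 2) * (bb a 0 + bb a 2))) := by
      have t1 : A2 / (2 * d) = -(alf a (γ, M) 2) * γ 2 + dot3 γ γ * bb a 2 * M 2
          - (bb a 2) ^ 2 * M 2 / (2 * d) := by
        rw [hA2]
        simp only [alf, dot3, Fin.sum_univ_three, hb0, hb1, hb2]
        field_simp
      have t2 : K = 2 * d * dot3 γ γ - (bb a 0 + bb a 1 + bb a 2) := by
        rw [hK]
        simp only [dot3, Fin.sum_univ_three, hb0, hb1, hb2]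
        ring
      rw [t1, t2]
      simp only [fmm, f2, ← hG]
      rw [Finset.prod_pair (by decide), Finset.prod_pair (by decide)]
    rw [e]
    have t3 : (B2 / (8 * (c0 * c1 * c2))) = γ 2 * (alf a (γ, M) 2 * bb a 2 / ((bb a 2 + bb a 0) * (bb a 2 + bb a 1))
        + ((bb a 2 - bb a 0) * (bb a 2 - bb a 1)) * bb a 2 * γ 2 * M 2 /
          ((bb a 0 + bb a 1) * (bb a 1 + bb a 2) * (bb a 0 + bb a 2))) := by
      rw [hB2]
      simp only [alf, dot3, Fin.sum_univ_three, hb0, hb1, hb2, q01, q10, q02, q20, q12, q21]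
      field_simp
      ring
    rw [t3]
    ring
  have hS2' : pmg a d γ 0 2 * M 0 + pmg a d γ 1 2 * M 1 + pmg a d γ 2 2 * M 2
      = G * (S2 / (2 * d)) := by
    rw [hS2]
    simp [pmg, ← hG, hb0, hb1, hb2]
    field_simp
  have key2 : (4 * W * A0 - d * K * B0) * (W * ((c0 * c2) * M 1 * M 2 - (c0 * c1) * M 2 * M 1) + d * L * ((c0 * c2) * γ 1 * M 2 - (c0 * c1) * γ 2 * M 1))
    + (4 * W * A1 - d * K * B1) * (W * ((c0 * c1) * M 2 * M 0 - (c1 * c2) * M 0 * M 2) + d * L * ((c0 * c1) * γ 2 * M 0 - (c1 * c2) * γ 0 * M 2))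
    + (4 * W * A2 - d * K * B2) * (W * ((c1 * c2) * M 0 * M 1 - (c0 * c2) * M 1 * M 0) + d * L * ((c1 * c2) * γ 0 * M 1 - (c0 * c2) * γ 1 * M 0))
    - 4 * d * L * (S0 * (c1 * c2) * (W * M 0 + d * L * γ 0) + S1 * (c0 * c2) * (W * M 1 + d * L * γ 1)
      + S2 * (c0 * c1) * (W * M 2 + d * L * γ 2)) = 0 := by
    rw [hL, hW, hK, hA0, hA1, hA2, hB0, hB1, hB2, hS0, hS1, hS2]
    exact key
  clear key
  clear hL hW hK hA0 hA1 hA2 hB0 hB1 hB2 hS0 hS1 hS2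
  unfold pb
  simp only [e1, hF, Fintype.sum_sum_type, Sum.elim_inl, Sum.elim_inr, Fin.sum_univ_three,
    piB]
  simp only [hLL, hGW, ha0, ha1, ha2]
  simp [eps]
  have hGi : G = G⁻¹ * (W / (c0 * c1 * c2)) := by
    rw [← hGW]; field_simp
  obtain ⟨u, hu⟩ : ∃ u, u = G⁻¹ := ⟨_, rfl⟩
  rw [← hu] at hGi hf0 hf1 hf2
  rw [hGi] at hf0 hf1 hf2 hS0' hS1' hS2'
  have r0 : fmm a d (γ, M) 0 = u / (8 * d * (c0 * c1 * c2)) * (4 * W * A0 - d * K * B0) := by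
    rw [hf0]; field_simp; ring
  have r1 : fmm a d (γ, M) 1 = u / (8 * d * (c0 * c1 * c2)) * (4 * W * A1 - d * K * B1) := by
    rw [hf1]; field_simp; ring
  have r2 : fmm a d (γ, M) 2 = u / (8 * d * (c0 * c1 * c2)) * (4 * W * A2 - d * K * B2) := by
    rw [hf2]; field_simp; ring
  rw [r0, r1, r2]
  -- collect everything into a multiple of the algebraic core
  have fin : -2 * (2 * d * (L / (c0 * c1 * c2)) * (c0⁻¹ * M 0) * (c0 * c1 * c2 / W) +
        2 * d ^ 2 * (L / (c0 * c1 * c2)) ^ 2 * (c0⁻¹ * γ 0) * (c0 * c1 * c2 / W) ^ 2) *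
        (u * (W / (c0 * c1 * c2)) * (S0 / (2 * d)))
      + -2 * (2 * d * (L / (c0 * c1 * c2)) * (c1⁻¹ * M 1) * (c0 * c1 * c2 / W) +
        2 * d ^ 2 * (L / (c0 * c1 * c2)) ^ 2 * (c1⁻¹ * γ 1) * (c0 * c1 * c2 / W) ^ 2) *
        (u * (W / (c0 * c1 * c2)) * (S1 / (2 * d)))
      + -2 * (2 * d * (L / (c0 * c1 * c2)) * (c2⁻¹ * M 2) * (c0 * c1 * c2 / W) +
        2 * d ^ 2 * (L / (c0 * c1 * c2)) ^ 2 * (c2⁻¹ * γ 2) * (c0 * c1 * c2 / W) ^ 2) *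
        (u * (W / (c0 * c1 * c2)) * (S2 / (2 * d)))
      + (u / (8 * d * (c0 * c1 * c2)) * (4 * W * A0 - d * K * B0)) *
        ((2 * (c1⁻¹ * M 1) + 2 * d * (L / (c0 * c1 * c2)) * (c1⁻¹ * γ 1) * (c0 * c1 * c2 / W)) * (2 * M 2)
        - (2 * (c2⁻¹ * M 2) + 2 * d * (L / (c0 * c1 * c2)) * (c2⁻¹ * γ 2) * (c0 * c1 * c2 / W)) * (2 * M 1))
      + (u / (8 * d * (c0 * c1 * c2)) * (4 * W * A1 - d * K * B1)) *
        ((2 * (c2⁻¹ * M 2) + 2 * d * (L / (c0 * c1 * c2)) * (c2⁻¹ * γ 2) * (c0 * c1 * c2 / W)) * (2 * M 0)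
        - (2 * (c0⁻¹ * M 0) + 2 * d * (L / (c0 * c1 * c2)) * (c0⁻¹ * γ 0) * (c0 * c1 * c2 / W)) * (2 * M 2))
      + (u / (8 * d * (c0 * c1 * c2)) * (4 * W * A2 - d * K * B2)) *
        ((2 * (c0⁻¹ * M 0) + 2 * d * (L / (c0 * c1 * c2)) * (c0⁻¹ * γ 0) * (c0 * c1 * c2 / W)) * (2 * M 1)
        - (2 * (c1⁻¹ * M 1) + 2 * d * (L / (c0 * c1 * c2)) * (c1⁻¹ * γ 1) * (c0 * c1 * c2 / W)) * (2 * M 0))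
      = u / (2 * d * (c0 * c1 * c2) ^ 2 * W) * ( (4 * W * A0 - d * K * B0) * (W * ((c0 * c2) * M 1 * M 2 - (c0 * c1) * M 2 * M 1) + d * L * ((c0 * c2) * γ 1 * M 2 - (c0 * c1) * γ 2 * M 1))
    + (4 * W * A1 - d * K * B1) * (W * ((c0 * c1) * M 2 * M 0 - (c1 * c2) * M 0 * M 2) + d * L * ((c0 * c1) * γ 2 * M 0 - (c1 * c2) * γ 0 * M 2))
    + (4 * W * A2 - d * K * B2) * (W * ((c1 * c2) * M 0 * M 1 - (c0 * c2) * M 1 * M 0) + d * L * ((c1 * c2) * γ 0 * M 1 - (c0 * c2) * γ 1 * M 0))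
    - 4 * d * L * (S0 * (c1 * c2) * (W * M 0 + d * L * γ 0) + S1 * (c0 * c2) * (W * M 1 + d * L * γ 1)
      + S2 * (c0 * c1) * (W * M 2 + d * L * γ 2))) := by
    field_simp
    ring
  rw [key2, mul_zero] at fin
  linear_combination fin
    - 2 * (2 * d * (L / (c0 * c1 * c2)) * (c0⁻¹ * M 0) * (c0 * c1 * c2 / W) +
        2 * d ^ 2 * (L / (c0 * c1 * c2)) ^ 2 * (c0⁻¹ * γ 0) * (c0 * c1 * c2 / W) ^ 2) * hS0'
    - 2 * (2 * d * (L / (c0 * c1 * c2)) * (c1⁻¹ * M 1) * (c0 * c1 * c2 / W) +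
        2 * d ^ 2 * (L / (c0 * c1 * c2)) ^ 2 * (c1⁻¹ * γ 1) * (c0 * c1 * c2 / W) ^ 2) * hS1'
    - 2 * (2 * d * (L / (c0 * c1 * c2)) * (c2⁻¹ * M 2) * (c0 * c1 * c2 / W) +
        2 * d ^ 2 * (L / (c0 * c1 * c2)) ^ 2 * (c2⁻¹ * γ 2) * (c0 * c1 * c2 / W) ^ 2) * hS2'
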